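/- Let K be a field, R = K[x_1,...,x_n], d a positive integer, and α: R → R the K-algebra map with α(x_i) = x_i^d for all i. For a homogeneous ideal I of R set I' = α(I)R, the extension of the image of I. Then reg(I) ≤ reg(I')/d. -/

import Mathlib

open MvPolynomial

variable {K : Type} [Field K]

/-- The degree-`k` homogeneous component of a homogeneous ideal `I`,
as a `K`-vector subspace of the polynomial ring (zero in negative degrees). -/
noncomputable def idealPiece {n : ℕ} (I : Ideal (MvPolynomial (Fin n) K)) (k : ℤ) :
    Submodule K (MvPolynomial (Fin n) K) :=
  if 0 ≤ k then
    (Submodule.restrictScalars K (I : Submodule (MvPolynomial (Fin n) K) (MvPolynomial (Fin n) K)))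
      ⊓ (homogeneousSubmodule (Fin n) K k.toNat)
  else ⊥

lemma mul_X_mem_idealPiece {n : ℕ} (I : Ideal (MvPolynomial (Fin n) K)) (t : Fin n) (k : ℤ)
    {x : MvPolynomial (Fin n) K} (hx : x ∈ idealPiece I k) :
    (X t : MvPolynomial (Fin n) K) * x ∈ idealPiece I (k + 1) := by
  by_cases h : 0 ≤ k
  · rw [idealPiece, if_pos h] at hx
    rw [idealPiece, if_pos (by omega)]
    refine ⟨I.mul_mem_left _ hx.1, ?_⟩
    rw [Submodule.mem_inf] at hx
    have hh : x.IsHomogeneous k.toNat := (mem_homogeneousSubmodule _ _).1 hx.2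
    have : ((X t : MvPolynomial (Fin n) K) * x).IsHomogeneous (1 + k.toNat) :=
      (isHomogeneous_X K t).mul hh
    have he : (k + 1).toNat = 1 + k.toNat := by omega
    exact (mem_homogeneousSubmodule _ _).2 (he ▸ this)
  · rw [idealPiece, if_neg h, Submodule.mem_bot] at hx
    rw [hx, mul_zero]
    exact Submodule.zero_mem _

/-- Multiplication by the variable `X t` as a linear map between graded pieces. -/
noncomputable def mulXPiece {n : ℕ} (I : Ideal (MvPolynomial (Fin n) K)) (t : Fin n) (k : ℤ) :
    idealPiece I k →ₗ[K] idealPiece I (k + 1) :=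
  (LinearMap.mulLeft K (X t)).restrict (fun _ hx => mul_X_mem_idealPiece I t k hx)

/-- Index set of the `i`-th term of the Koszul complex: subsets of the variables of size `i`. -/
abbrev KoszulIdx (n i : ℕ) := {s : Finset (Fin n) // s.card = i}

/-- The Koszul differential (in internal degree `j`) of the complex computing
`Tor(I, K)`, from homological degree `i+1` to homological degree `i`. -/
noncomputable def koszulDiff {n : ℕ} (I : Ideal (MvPolynomial (Fin n) K)) (i : ℕ) (j : ℤ) :
    ((KoszulIdx n (i + 1)) → idealPiece I (j - (i + 1 : ℕ)))
      →ₗ[K] ((KoszulIdx n i) → idealPiece I (j - (i : ℕ))) :=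
  ∑ s' : KoszulIdx n (i + 1), ∑ t ∈ (s' : Finset (Fin n)).attach,
    ((-1 : K) ^ (((s' : Finset (Fin n)).filter (fun u => u < t.1)).card)) •
      ((LinearMap.single (R := K) (φ := fun _ : KoszulIdx n i => idealPiece I (j - (i : ℕ)))
          ⟨(s' : Finset (Fin n)).erase t.1, by
            rw [Finset.card_erase_of_mem t.2, s'.2]; rfl⟩) ∘ₗ
        (LinearEquiv.ofEq _ _ (by rw [show j - ((i : ℕ) + 1 : ℕ) + 1 = j - (i : ℕ) by push_cast; ring])).toLinearMap ∘ₗ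
        (mulXPiece I t.1 (j - ((i : ℕ) + 1 : ℕ))) ∘ₗ
        (LinearMap.proj s'))

/-- Cycles of the Koszul complex at homological degree `i`, internal degree `j`. -/
noncomputable def koszulCycles {n : ℕ} (I : Ideal (MvPolynomial (Fin n) K)) :
    (i : ℕ) → (j : ℤ) → Submodule K ((KoszulIdx n i) → idealPiece I (j - (i : ℕ)))
  | 0, _ => ⊤
  | (i + 1), j => LinearMap.ker (koszulDiff I i j)

set_option synthInstance.maxHeartbeats 1000000 in
set_option maxHeartbeats 1000000 in
/-- The graded Betti number `β_{i,j}(I) = dim_K Tor_i(I, K)_j`, computed as the dimension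
of the homology of the Koszul complex (all spaces involved are finite-dimensional, so the
dimension of the homology `Z/B` is `dim Z - dim (B ⊓ Z)`). -/
noncomputable def gradedBetti {n : ℕ} (I : Ideal (MvPolynomial (Fin n) K)) (i : ℕ) (j : ℤ) : ℕ :=
  Module.finrank K ↥(koszulCycles I i j) -
    Module.finrank K ↥(LinearMap.range (koszulDiff I i j) ⊓ koszulCycles I i j)

/-- The Castelnuovo–Mumford regularity `reg(I) = max { j - i : β_{i,j}(I) ≠ 0 }`. -/
noncomputable def reg {n : ℕ} (I : Ideal (MvPolynomial (Fin n) K)) : ℤ :=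
  sSup {r : ℤ | ∃ (i : ℕ) (j : ℤ), gradedBetti I i j ≠ 0 ∧ r = j - i}

/-- `t_i(I) = max { j : β_{i,j}(I) ≠ 0 }`, the maximal shift in homological degree `i`. -/
noncomputable def maxShift {n : ℕ} (I : Ideal (MvPolynomial (Fin n) K)) (i : ℕ) : ℤ :=
  sSup {j : ℤ | gradedBetti I i j ≠ 0}

/-- The projective dimension of `I`. -/
noncomputable def projdim {n : ℕ} (I : Ideal (MvPolynomial (Fin n) K)) : ℕ :=
  sSup {i : ℕ | ∃ j : ℤ, gradedBetti I i j ≠ 0}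

/-- An ideal of a polynomial ring is homogeneous (for the standard grading) if it contains
all homogeneous components of its elements. -/
def IsHomogeneousIdeal {n : ℕ} (I : Ideal (MvPolynomial (Fin n) K)) : Prop :=
  ∀ f ∈ I, ∀ k : ℕ, homogeneousComponent k f ∈ I

/-- The sign `(-1) ^ #{u ∈ s | u < t}` of the Koszul complex. -/
noncomputable def koszulSign {n : ℕ} (s : Finset (Fin n)) (t : Fin n) : MvPolynomial (Fin n) K :=
  (-1) ^ (s.filter (fun u => u < t)).card

lemma koszulSign_mul_self {n : ℕ} (s : Finset (Fin n)) (t : Fin n) :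
    (koszulSign s t * koszulSign s t : MvPolynomial (Fin n) K) = 1 := by
  rw [koszulSign, ← mul_pow]
  simp

lemma koszulSign_erase_self {n : ℕ} (s : Finset (Fin n)) (t : Fin n) :
    (koszulSign (s.erase t) t : MvPolynomial (Fin n) K) = koszulSign s t := by
  rw [koszulSign, koszulSign]
  congr 2
  ext u
  simp only [Finset.mem_filter, Finset.mem_erase]
  exact ⟨fun h => ⟨h.1.2, h.2⟩, fun h => ⟨⟨h.2.ne, h.1⟩, h.2⟩⟩

lemma koszulSign_insert_self {n : ℕ} (s : Finset (Fin n)) (t : Fin n) :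
    (koszulSign (insert t s) t : MvPolynomial (Fin n) K) = koszulSign s t := by
  rw [koszulSign, koszulSign]
  congr 2
  ext u
  simp only [Finset.mem_filter, Finset.mem_insert]
  exact ⟨fun h => ⟨h.1.resolve_left h.2.ne, h.2⟩, fun h => ⟨Or.inr h.1, h.2⟩⟩

lemma koszulSign_insert {n : ℕ} {s : Finset (Fin n)} {u : Fin n} (hu : u ∉ s) (t : Fin n) :
    (koszulSign (insert u s) t : MvPolynomial (Fin n) K) =
      if u < t then -koszulSign s t else koszulSign s t := by
  rw [koszulSign, koszulSign, Finset.filter_insert]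
  split_ifs
  · rw [Finset.card_insert_of_notMem (by simp [hu]), pow_succ]
    ring
  · rfl

lemma koszulSign_mul_koszulSign_insert {n : ℕ} {s : Finset (Fin n)} {t u : Fin n}
    (ht : t ∈ s) (hu : u ∉ s) :
    (koszulSign s u * koszulSign (insert u s) t : MvPolynomial (Fin n) K) =
      -(koszulSign s t * koszulSign (s.erase t) u) := by
  have h := koszulSign_insert (K := K) (Finset.notMem_erase t s) u
  rw [Finset.insert_erase ht] at h
  have hut : u ≠ t := fun h => hu (h ▸ ht)
  rw [h, koszulSign_insert hu]
  rcases lt_or_gt_of_ne hut with h' | h'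
  · rw [if_neg h'.not_gt, if_pos h']; ring
  · rw [if_pos h', if_neg h'.not_gt]; ring

/-- The Koszul differential on the exterior algebra over the polynomial ring; a family `w` stands
for the element `∑ s, w s • e_s`. -/
noncomputable def koszulD (K : Type) [Field K] (n : ℕ) :
    (Finset (Fin n) → MvPolynomial (Fin n) K) →ₗ[MvPolynomial (Fin n) K]
      (Finset (Fin n) → MvPolynomial (Fin n) K) :=
  LinearMap.pi fun s => ∑ t ∈ sᶜ, (koszulSign s t * X t : MvPolynomial (Fin n) K) •
    LinearMap.proj (insert t s)

lemma koszulD_apply {n : ℕ} (w : Finset (Fin n) → MvPolynomial (Fin n) K) (s : Finset (Fin n)) :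
    koszulD K n w s = ∑ t ∈ sᶜ, koszulSign s t * X t * w (insert t s) := by
  simp [koszulD]

/-- Exterior multiplication by the basis vector `e_t`. -/
noncomputable def wedge {n : ℕ} (t : Fin n) (w : Finset (Fin n) → MvPolynomial (Fin n) K) :
    Finset (Fin n) → MvPolynomial (Fin n) K :=
  fun s => if t ∈ s then koszulSign s t * w (s.erase t) else 0

/-- On cycles, multiplication by `X t` is null-homotopic. -/
lemma koszulD_wedge {n : ℕ} (t : Fin n) {w : Finset (Fin n) → MvPolynomial (Fin n) K}
    (hw : koszulD K n w = 0) :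
    koszulD K n (wedge t w) = (X t : MvPolynomial (Fin n) K) • w := by
  funext s
  rw [koszulD_apply, Pi.smul_apply, smul_eq_mul]
  by_cases ht : t ∈ s
  · have h := congrFun hw (s.erase t)
    have hc : (s.erase t)ᶜ = insert t sᶜ := by
      rw [Finset.compl_erase]
    rw [koszulD_apply, hc, Finset.sum_insert (by simp [ht]), Finset.insert_erase ht,
      koszulSign_erase_self, Pi.zero_apply] at h
    have h2 : (X t : MvPolynomial (Fin n) K) * w s = -(koszulSign s t *
        ∑ u ∈ sᶜ, koszulSign (s.erase t) u * X u * w (insert u (s.erase t))) := by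
      rw [eq_neg_of_add_eq_zero_right h]
      linear_combination (- (X t * w s)) * koszulSign_mul_self (K := K) s t
    rw [h2, Finset.mul_sum, ← Finset.sum_neg_distrib]
    refine Finset.sum_congr rfl fun u hu => ?_
    rw [Finset.mem_compl] at hu
    have hut : u ≠ t := fun h => hu (h ▸ ht)
    rw [wedge, if_pos (Finset.mem_insert_of_mem ht), Finset.erase_insert_of_ne hut]
    linear_combination (X u * w (insert u (s.erase t))) *
      koszulSign_mul_koszulSign_insert (K := K) ht hu
  · rw [Finset.sum_eq_single t]
    · rw [wedge, if_pos (Finset.mem_insert_self t s), Finset.erase_insert ht,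
        koszulSign_insert_self]
      linear_combination (X t * w s) * koszulSign_mul_self (K := K) s t
    · intro u _ hut
      rw [wedge, if_neg (by simp [ht, hut.symm]), mul_zero]
    · simp [ht]

lemma mem_idealPiece_iff {n : ℕ} {I : Ideal (MvPolynomial (Fin n) K)} {k : ℤ}
    {f : MvPolynomial (Fin n) K} :
    f ∈ idealPiece I k ↔ f ∈ I ∧ ∀ m ∈ f.support, ((Finsupp.degree m : ℕ) : ℤ) = k := by
  by_cases h : 0 ≤ k
  · rw [idealPiece, if_pos h, Submodule.mem_inf, Submodule.restrictScalars_mem,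
      mem_homogeneousSubmodule]
    refine and_congr_right fun _ => ⟨fun hf m hm => ?_, fun hf m hm => ?_⟩
    · have := hf.degree_eq_sum_deg_support hm
      rw [← Finsupp.degree_apply] at this
      omega
    · have := hf m (mem_support_iff.2 hm)
      change Finsupp.weight (fun _ => 1) m = _
      rw [← Finsupp.degree_eq_weight_one]
      omega
  · rw [idealPiece, if_neg h, Submodule.mem_bot]
    refine ⟨fun hf => by simp [hf], fun hf => ?_⟩
    rw [← support_eq_empty, Finset.eq_empty_iff_forall_notMem]
    intro m hm
    have := hf.2 m hm
    omega

/-- The degree `k` part of the `i`-th exterior power with coefficients in the ideal `I`. -/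
def koszulChains {n : ℕ} (I : Ideal (MvPolynomial (Fin n) K)) (i : ℕ) (k : ℤ) :
    Submodule K (Finset (Fin n) → MvPolynomial (Fin n) K) where
  carrier := {w | ∀ s : Finset (Fin n),
    (s.card = i → w s ∈ idealPiece I k) ∧ (s.card ≠ i → w s = 0)}
  add_mem' ha hb s :=
    ⟨fun h => add_mem ((ha s).1 h) ((hb s).1 h), fun h => by
      rw [Pi.add_apply, (ha s).2 h, (hb s).2 h, add_zero]⟩
  zero_mem' _ := ⟨fun _ => zero_mem _, fun _ => rfl⟩
  smul_mem' c _ ha s :=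
    ⟨fun h => Submodule.smul_mem _ c ((ha s).1 h), fun h => by
      rw [Pi.smul_apply, (ha s).2 h, smul_zero]⟩

lemma wedge_mem_koszulChains {n : ℕ} {I : Ideal (MvPolynomial (Fin n) K)} {i : ℕ} {k : ℤ}
    {w : Finset (Fin n) → MvPolynomial (Fin n) K} (hw : w ∈ koszulChains I i k) (t : Fin n) :
    wedge t w ∈ koszulChains I (i + 1) k := by
  intro s
  by_cases ht : t ∈ s
  · have hc := Finset.card_erase_add_one ht
    rw [wedge, if_pos ht]
    refine ⟨fun h => ?_, fun h => ?_⟩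
    · have := (hw (s.erase t)).1 (by omega)
      rcases neg_one_pow_eq_or (MvPolynomial (Fin n) K) (s.filter (fun u => u < t)).card with e | e
      · rwa [koszulSign, e, one_mul]
      · rw [koszulSign, e, neg_one_mul]
        exact neg_mem this
    · rw [(hw (s.erase t)).2 (by omega), mul_zero]
  · rw [wedge, if_neg ht]
    exact ⟨fun _ => zero_mem _, fun _ => rfl⟩

lemma monomial_smul_mem_koszulChains {n : ℕ} {I : Ideal (MvPolynomial (Fin n) K)} {i : ℕ} {k : ℤ}
    {w : Finset (Fin n) → MvPolynomial (Fin n) K} (hw : w ∈ koszulChains I i k)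
    (m : Fin n →₀ ℕ) (a : K) :
    monomial m a • w ∈ koszulChains I i (k + (Finsupp.degree m : ℕ)) := by
  intro s
  refine ⟨fun h => ?_, fun h => by simp [(hw s).2 h]⟩
  have := (hw s).1 h
  rw [mem_idealPiece_iff] at this ⊢
  refine ⟨I.mul_mem_left _ this.1, fun m' hm' => ?_⟩
  rw [Pi.smul_apply, smul_eq_mul] at hm'
  obtain ⟨p, hp, q, hq, rfl⟩ := Finset.mem_add.1 (support_mul _ _ hm')
  obtain rfl := Finset.mem_singleton.1 (support_monomial_subset hp)
  have := this.2 q hq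
  rw [map_add]
  push_cast
  omega

/-- Extension by zero of a family indexed by the subsets of size `i`. -/
noncomputable def koszulExtend {n : ℕ} {I : Ideal (MvPolynomial (Fin n) K)} {i : ℕ} {k : ℤ}
    (w : KoszulIdx n i → idealPiece I k) : Finset (Fin n) → MvPolynomial (Fin n) K :=
  fun s => if h : s.card = i then (w ⟨s, h⟩ : MvPolynomial (Fin n) K) else 0

lemma koszulExtend_mem {n : ℕ} {I : Ideal (MvPolynomial (Fin n) K)} {i : ℕ} {k : ℤ}
    (w : KoszulIdx n i → idealPiece I k) : koszulExtend w ∈ koszulChains I i k := by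
  intro s
  refine ⟨fun h => ?_, fun h => dif_neg h⟩
  rw [koszulExtend, dif_pos h]
  exact (w _).2

lemma exists_koszulExtend_eq {n : ℕ} {I : Ideal (MvPolynomial (Fin n) K)} {i : ℕ} {k : ℤ}
    {w : Finset (Fin n) → MvPolynomial (Fin n) K} (hw : w ∈ koszulChains I i k) :
    ∃ v : KoszulIdx n i → idealPiece I k, koszulExtend v = w := by
  refine ⟨fun s => ⟨w s.1, (hw s.1).1 s.2⟩, funext fun s => ?_⟩
  rw [koszulExtend]
  split_ifs with h
  · rfl
  · exact ((hw s).2 h).symm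

lemma koszulExtend_injective {n : ℕ} {I : Ideal (MvPolynomial (Fin n) K)} {i : ℕ} {k : ℤ} :
    Function.Injective
      (koszulExtend : (KoszulIdx n i → idealPiece I k) → Finset (Fin n) → MvPolynomial (Fin n) K) := by
  intro v w h
  funext s
  have := congrFun h s.1
  rw [koszulExtend, koszulExtend, dif_pos s.2, dif_pos s.2] at this
  exact Subtype.ext this

lemma coe_koszulDiff_apply {n : ℕ} (I : Ideal (MvPolynomial (Fin n) K)) (i : ℕ) (j : ℤ)
    (w : KoszulIdx n (i + 1) → idealPiece I (j - (i + 1 : ℕ))) (s : KoszulIdx n i) :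
    (koszulDiff I i j w s : MvPolynomial (Fin n) K) = koszulD K n (koszulExtend w) s.1 := by
  have key : ∀ s' : KoszulIdx n (i + 1),
      ∑ t ∈ (s' : Finset (Fin n)).attach, (if s'.1.erase t.1 = s.1 then
        koszulSign s'.1 t.1 * (X t.1 * (w s' : MvPolynomial (Fin n) K)) else 0) =
      ∑ t ∈ s.1ᶜ, if s'.1 = insert t s.1 then
        koszulSign s.1 t * X t * koszulExtend w (insert t s.1) else 0 := by
    intro s'
    rw [Finset.sum_attach s'.1 (fun t => if s'.1.erase t = s.1 then
        koszulSign s'.1 t * (X t * (w s' : MvPolynomial (Fin n) K)) else 0),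
      ← Finset.sum_filter, ← Finset.sum_filter]
    refine Finset.sum_congr ?_ fun t ht => ?_
    · ext t
      simp only [Finset.mem_filter, Finset.mem_compl]
      constructor
      · rintro ⟨h1, h2⟩
        rw [← h2, Finset.insert_erase h1]
        exact ⟨Finset.notMem_erase t _, rfl⟩
      · rintro ⟨h1, h2⟩
        rw [h2, Finset.erase_insert h1]
        exact ⟨Finset.mem_insert_self t _, rfl⟩
    · rw [Finset.mem_filter] at ht
      rw [← ht.2, koszulExtend, dif_pos s'.2, ← koszulSign_insert_self s.1, ← ht.2, mul_assoc]
  have expand : (koszulDiff I i j w s : MvPolynomial (Fin n) K) = ∑ s' : KoszulIdx n (i + 1),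
      ∑ t ∈ (s' : Finset (Fin n)).attach, (if s'.1.erase t.1 = s.1 then
        koszulSign s'.1 t.1 * (X t.1 * (w s' : MvPolynomial (Fin n) K)) else 0) := by
    rw [koszulDiff, LinearMap.sum_apply, Finset.sum_apply, Submodule.coe_sum]
    refine Finset.sum_congr rfl fun s' _ => ?_
    rw [LinearMap.sum_apply, Finset.sum_apply, Submodule.coe_sum]
    refine Finset.sum_congr rfl fun t _ => ?_
    rw [LinearMap.smul_apply, Pi.smul_apply, Submodule.coe_smul, smul_eq_C_mul]
    simp only [LinearMap.comp_apply, LinearMap.single_apply, LinearMap.proj_apply, Pi.single_apply]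
    split_ifs with h1 h2 h2
    · rw [koszulSign, map_pow, map_neg, map_one]
      rfl
    · exact absurd (congrArg Subtype.val h1).symm h2
    · exact absurd (Subtype.ext h2.symm) h1
    · simp
  rw [expand, Finset.sum_congr rfl fun s' _ => key s', Finset.sum_comm, koszulD_apply]
  refine Finset.sum_congr rfl fun t ht => ?_
  have hc : (insert t s.1).card = i + 1 := by
    rw [Finset.card_insert_of_notMem (Finset.mem_compl.1 ht), s.2]
  rw [Finset.sum_eq_single ⟨insert t s.1, hc⟩]
  · rw [if_pos rfl]
  · intro s' _ h
    rw [if_neg fun h' => h (Subtype.ext h')]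
  · simp

lemma koszulExtend_koszulDiff {n : ℕ} (I : Ideal (MvPolynomial (Fin n) K)) (i : ℕ) (j : ℤ)
    (w : KoszulIdx n (i + 1) → idealPiece I (j - (i + 1 : ℕ))) :
    koszulExtend (koszulDiff I i j w) = koszulD K n (koszulExtend w) := by
  funext s
  rw [koszulExtend]
  split_ifs with h
  · exact coe_koszulDiff_apply I i j w ⟨s, h⟩
  · rw [koszulD_apply]
    refine (Finset.sum_eq_zero fun t ht => ?_).symm
    rw [koszulExtend, dif_neg, mul_zero]
    rw [Finset.card_insert_of_notMem (Finset.mem_compl.1 ht)]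
    omega

lemma mem_koszulCycles_iff {n : ℕ} (I : Ideal (MvPolynomial (Fin n) K)) (i : ℕ) (j : ℤ)
    (w : KoszulIdx n i → idealPiece I (j - (i : ℕ))) :
    w ∈ koszulCycles I i j ↔ koszulD K n (koszulExtend w) = 0 := by
  cases i with
  | zero =>
    refine iff_of_true trivial (funext fun s => ?_)
    rw [koszulD_apply]
    refine Finset.sum_eq_zero fun t _ => ?_
    rw [koszulExtend, dif_neg (by simp), mul_zero]
  | succ i =>
    rw [koszulCycles, LinearMap.mem_ker, ← koszulExtend_koszulDiff]
    have h0 : koszulExtend (0 : KoszulIdx n i → idealPiece I (j - (i : ℕ))) = 0 := by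
      funext s
      simp [koszulExtend]
    rw [← h0, koszulExtend_injective.eq_iff]

instance finite_idealPiece {n : ℕ} (I : Ideal (MvPolynomial (Fin n) K)) (k : ℤ) :
    Module.Finite K (idealPiece I k) := by
  have : Module.Finite K (homogeneousSubmodule (Fin n) K k.toNat) :=
    Module.Finite.iff_fg.2 (homogeneousSubmodule_fg _ K _)
  refine Submodule.finiteDimensional_of_le (S₂ := homogeneousSubmodule (Fin n) K k.toNat) ?_
  rw [idealPiece]
  split_ifs
  · exact inf_le_right
  · exact bot_le

lemma gradedBetti_ne_zero_iff {n : ℕ} (I : Ideal (MvPolynomial (Fin n) K)) (i : ℕ) (j : ℤ) :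
    gradedBetti I i j ≠ 0 ↔ ∃ w ∈ koszulChains I i (j - i), koszulD K n w = 0 ∧
      ∀ v ∈ koszulChains I (i + 1) (j - (i + 1 : ℕ)), koszulD K n v ≠ w := by
  have h1 : gradedBetti I i j ≠ 0 ↔
      ¬ koszulCycles I i j ≤ LinearMap.range (koszulDiff I i j) := by
    rw [← inf_eq_right, gradedBetti, Nat.sub_ne_zero_iff_lt]
    refine ⟨fun h h' => by rw [h'] at h; exact h.false, fun h => ?_⟩
    exact Submodule.finrank_lt_finrank_of_lt (lt_of_le_of_ne inf_le_right h)
  rw [h1, SetLike.not_le_iff_exists]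
  constructor
  · rintro ⟨w, hw, hr⟩
    refine ⟨koszulExtend w, koszulExtend_mem w, (mem_koszulCycles_iff I i j w).1 hw, ?_⟩
    intro v hv hvw
    obtain ⟨v, rfl⟩ := exists_koszulExtend_eq hv
    rw [← koszulExtend_koszulDiff] at hvw
    exact hr ⟨v, koszulExtend_injective hvw⟩
  · rintro ⟨w, hw, h0, hv⟩
    obtain ⟨w, rfl⟩ := exists_koszulExtend_eq hw
    refine ⟨w, (mem_koszulCycles_iff I i j w).2 h0, ?_⟩
    rintro ⟨v, rfl⟩
    exact hv _ (koszulExtend_mem v) (koszulExtend_koszulDiff I i j v).symm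

/-- The graded Betti numbers in a fixed homological degree vanish in large internal degrees. -/
lemma exists_gradedBetti_eq_zero {n : ℕ} (I : Ideal (MvPolynomial (Fin n) K)) (i : ℕ) :
    ∃ N : ℤ, ∀ j : ℤ, N < j - i → gradedBetti I i j = 0 := by
  let Z : ℕ →o Submodule (MvPolynomial (Fin n) K) (Finset (Fin n) → MvPolynomial (Fin n) K) :=
    { toFun := fun N => Submodule.span _
        {w | ∃ q : ℤ, q ≤ N ∧ w ∈ koszulChains I i q ∧ koszulD K n w = 0}
      monotone' := fun a b hab => Submodule.span_mono fun w ⟨q, hq, h⟩ => ⟨q, by omega, h⟩ }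
  obtain ⟨N, hN⟩ := monotone_stabilizes_iff_noetherian.2 inferInstance Z
  refine ⟨N, fun j hj => ?_⟩
  by_contra hne
  obtain ⟨w, hw, hw0, hv⟩ := (gradedBetti_ne_zero_iff I i j).1 hne
  have hwN : w ∈ Z N := by
    rw [hN (j - i).toNat (by omega)]
    exact Submodule.subset_span ⟨j - i, by omega, hw, hw0⟩
  let comp : (Finset (Fin n) → MvPolynomial (Fin n) K) →ₗ[K]
      (Finset (Fin n) → MvPolynomial (Fin n) K) :=
    LinearMap.pi fun s => homogeneousComponent (j - i).toNat ∘ₗ LinearMap.proj s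
  have hcomp : ∀ (k : ℤ), 0 ≤ k → ∀ v ∈ koszulChains I i k,
      comp v = if k = j - i then v else 0 := by
    intro k hk v hv
    funext s
    change homogeneousComponent (j - i).toNat (v s) = _
    by_cases hs : s.card = i
    · have h := ((hv s).1 hs)
      rw [idealPiece, if_pos hk] at h
      rw [homogeneousComponent_of_mem h.2]
      by_cases hkj : k = j - i
      · simp [hkj]
      · rw [if_neg (by omega), if_neg hkj, Pi.zero_apply]
    · rw [(hv s).2 hs, map_zero]
      split_ifs
      · exact ((hv s).2 hs).symm
      · rfl
  let B : Submodule K (Finset (Fin n) → MvPolynomial (Fin n) K) :=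
    (koszulChains I (i + 1) (j - (i + 1 : ℕ))).map ((koszulD K n).restrictScalars K)
  have main : ∀ y ∈ Z N, ∀ c : MvPolynomial (Fin n) K, comp (c • y) ∈ B := by
    intro y hy
    refine Submodule.span_induction ?_ ?_ ?_ ?_ hy
    · rintro y ⟨q, hq, hy, hy0⟩ c
      induction c using MvPolynomial.induction_on' with
      | add p q hp hq =>
        rw [add_smul, map_add]
        exact add_mem hp hq
      | monomial m a =>
        have hm := monomial_smul_mem_koszulChains hy m a
        by_cases hq0 : 0 ≤ q
        · rw [hcomp _ (by omega) _ hm]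
          split_ifs with hdeg
          · have hm0 : m ≠ 0 := by
              rintro rfl
              simp at hdeg
              omega
            obtain ⟨t, ht⟩ := Finsupp.ne_iff.1 hm0
            have hle : Finsupp.single t 1 ≤ m :=
              Finsupp.single_le_iff.2 (Nat.one_le_iff_ne_zero.2 ht)
            obtain ⟨m, rfl⟩ := exists_add_of_le hle
            refine ⟨wedge t (monomial m a • y), ?_, ?_⟩
            · have := wedge_mem_koszulChains (monomial_smul_mem_koszulChains hy m a) t
              rw [map_add, Finsupp.degree_single] at hdeg
              have e : q + (Finsupp.degree m : ℕ) = j - (i + 1 : ℕ) := by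
                push_cast at hdeg ⊢
                omega
              rwa [e] at this
            · rw [LinearMap.restrictScalars_apply, koszulD_wedge t (by rw [map_smul, hy0, smul_zero]),
                smul_smul, X, monomial_mul, one_mul]
          · exact zero_mem _
        · have : y = 0 := by
            funext s
            by_cases hs : s.card = i
            · have := (hy s).1 hs
              rwa [idealPiece, if_neg hq0] at this
            · exact (hy s).2 hs
          rw [this, smul_zero, map_zero]
          exact zero_mem _
    · intro c
      rw [smul_zero, map_zero]
      exact zero_mem _
    · intro x y _ _ hx hy c
      rw [smul_add, map_add]
      exact add_mem (hx c) (hy c)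
    · intro a x _ hx c
      rw [smul_smul]
      exact hx _
  obtain ⟨v, hv', hvw⟩ := main w hwN 1
  rw [one_smul, hcomp _ (by omega) w hw, if_pos rfl] at hvw
  exact hv v hv' hvw

lemma nonneg_of_gradedBetti_ne_zero {n : ℕ} {I : Ideal (MvPolynomial (Fin n) K)} {i : ℕ} {j : ℤ}
    (h : gradedBetti I i j ≠ 0) : 0 ≤ j - i ∧ i ≤ n := by
  obtain ⟨w, hw, -, hv⟩ := (gradedBetti_ne_zero_iff I i j).1 h
  have hw0 : w ≠ 0 := fun h0 => hv 0 (zero_mem _) (by rw [map_zero, h0])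
  obtain ⟨s, hs⟩ := Function.ne_iff.1 hw0
  have hi : s.card = i := by
    by_contra hi
    exact hs ((hw s).2 hi)
  refine ⟨?_, hi ▸ card_finset_fin_le s⟩
  by_contra hneg
  have := (hw s).1 hi
  rw [idealPiece, if_neg hneg] at this
  exact hs this

lemma bddAbove_regSet {n : ℕ} (I : Ideal (MvPolynomial (Fin n) K)) :
    BddAbove {r : ℤ | ∃ (i : ℕ) (j : ℤ), gradedBetti I i j ≠ 0 ∧ r = j - i} := by
  choose N hN using exists_gradedBetti_eq_zero I
  obtain ⟨M, hM⟩ := ((Finset.range (n + 1)).image N).bddAbove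
  refine ⟨M, ?_⟩
  rintro r ⟨i, j, hij, rfl⟩
  have hi := (nonneg_of_gradedBetti_ne_zero hij).2
  have h1 : N i ≤ M := hM (by
    rw [Finset.mem_coe]
    exact Finset.mem_image_of_mem N (Finset.mem_range.2 (by omega)))
  by_contra hlt
  exact hij (hN i j (by omega))

/-- The retraction onto `X ^ ((d - 1) • 1_s) * K[X ^ d]`, followed by division by
`X ^ ((d - 1) • 1_s)` and by the inverse of `X ↦ X ^ d`. -/
noncomputable def powerRetract (K : Type) [Field K] {n : ℕ} (d : ℕ) (s : Finset (Fin n)) :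
    MvPolynomial (Fin n) K →ₗ[K] MvPolynomial (Fin n) K :=
  (basisMonomials (Fin n) K).constr K fun m =>
    if ∀ u, m u % d = if u ∈ s then d - 1 else 0 then
      monomial (m.mapRange (· / d) (Nat.zero_div d)) 1 else 0

lemma powerRetract_monomial {n : ℕ} (d : ℕ) (s : Finset (Fin n)) (m : Fin n →₀ ℕ) (a : K) :
    powerRetract K d s (monomial m a) =
      if ∀ u, m u % d = if u ∈ s then d - 1 else 0 then
        monomial (m.mapRange (· / d) (Nat.zero_div d)) a else 0 := by
  have h : (monomial m a : MvPolynomial (Fin n) K) = a • basisMonomials (Fin n) K m := by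
    simp [smul_monomial]
  rw [h, map_smul, powerRetract, Module.Basis.constr_basis]
  split_ifs
  · simp [smul_monomial]
  · simp

lemma powerRetract_X_mul {n : ℕ} {d : ℕ} (hd : 0 < d) {s : Finset (Fin n)} {t : Fin n}
    (ht : t ∉ s) (f : MvPolynomial (Fin n) K) :
    powerRetract K d s (X t * f) = X t * powerRetract K d (insert t s) f := by
  induction f using MvPolynomial.induction_on' with
  | add p q hp hq => rw [mul_add, map_add, map_add, mul_add, hp, hq]
  | monomial m a =>
    rw [X, monomial_mul, one_mul, powerRetract_monomial, powerRetract_monomial]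
    have hmod : (m t + 1) % d = 0 ↔ m t % d = d - 1 := by
      rw [← Nat.dvd_iff_mod_eq_zero]
      constructor
      · rintro ⟨c, hc⟩
        obtain ⟨c, rfl⟩ : ∃ e, c = e + 1 :=
          Nat.exists_eq_succ_of_ne_zero (by rintro rfl; simp at hc)
        have : m t = (d - 1) + d * c := by rw [mul_add] at hc; omega
        rw [this, Nat.add_mul_mod_self_left, Nat.mod_eq_of_lt (by omega)]
      · intro h
        refine ⟨m t / d + 1, ?_⟩
        have := Nat.div_add_mod (m t) d
        rw [mul_add]
        omega
    have hcond : (∀ u, (Finsupp.single t 1 + m : Fin n →₀ ℕ) u % d = if u ∈ s then d - 1 else 0) ↔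
        ∀ u, m u % d = if u ∈ insert t s then d - 1 else 0 := by
      refine forall_congr' fun u => ?_
      by_cases hu : u = t
      · subst hu
        simp [ht, add_comm 1, hmod]
      · simp [hu]
    by_cases h : ∀ u, m u % d = if u ∈ insert t s then d - 1 else 0
    · rw [if_pos (hcond.2 h), if_pos h, monomial_mul, one_mul]
      congr 2
      ext u
      rw [Finsupp.mapRange_apply, Finsupp.add_apply, Finsupp.add_apply, Finsupp.mapRange_apply]
      by_cases hu : u = t
      · subst hu
        have h1 := h u
        rw [if_pos (Finset.mem_insert_self u s)] at h1
        rw [Finsupp.single_eq_same, add_comm, add_comm 1, Nat.succ_div_of_dvd]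
        exact Nat.dvd_of_mod_eq_zero (hmod.2 h1)
      · rw [Finsupp.single_eq_of_ne hu, zero_add, zero_add]
    · rw [if_neg fun h' => h (hcond.1 h'), if_neg h, mul_zero]

/-- The `K`-algebra endomorphism `X i ↦ X i ^ d`. -/
noncomputable abbrev powerMap (K : Type) [Field K] (n d : ℕ) :
    MvPolynomial (Fin n) K →ₐ[K] MvPolynomial (Fin n) K :=
  aeval fun i => (X i : MvPolynomial (Fin n) K) ^ d

lemma powerMap_monomial {n : ℕ} (d : ℕ) (m : Fin n →₀ ℕ) (a : K) :
    powerMap K n d (monomial m a) = monomial (d • m) a := by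
  rw [aeval_monomial, monomial_eq, algebraMap_eq]
  congr 1
  rw [Finsupp.prod_fintype _ _ (by simp), Finsupp.prod_fintype _ _ (by simp)]
  simp [pow_mul]

lemma powerRetract_powerMap_mul {n : ℕ} {d : ℕ} (hd : 0 < d) (s : Finset (Fin n))
    (f g : MvPolynomial (Fin n) K) :
    powerRetract K d s (powerMap K n d f * g) = f * powerRetract K d s g := by
  induction f using MvPolynomial.induction_on' with
  | add p q hp hq => rw [map_add, add_mul, map_add, add_mul, hp, hq]
  | monomial m a =>
    induction g using MvPolynomial.induction_on' with
    | add p q hp hq => rw [mul_add, map_add, map_add, mul_add, hp, hq]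
    | monomial m' b =>
      rw [powerMap_monomial, monomial_mul, powerRetract_monomial, powerRetract_monomial]
      simp only [Finsupp.add_apply, Finsupp.smul_apply, smul_eq_mul, Nat.mul_add_mod]
      split_ifs
      · rw [monomial_mul]
        congr 2
        ext u
        simp [Nat.mul_add_div hd]
      · rw [mul_zero]

/-- The monomial `∏ t ∈ s, X t ^ (d - 1)`. -/
noncomputable def powerFactor (K : Type) [Field K] {n : ℕ} (d : ℕ) (s : Finset (Fin n)) :
    MvPolynomial (Fin n) K :=
  ∏ t ∈ s, X t ^ (d - 1)

lemma powerRetract_powerFactor {n : ℕ} {d : ℕ} (hd : 0 < d) (s : Finset (Fin n)) :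
    powerRetract K d s (powerFactor K d s) = 1 := by
  have h : powerFactor K d s = monomial (∑ t ∈ s, Finsupp.single t (d - 1)) 1 := by
    simp [powerFactor, monomial_sum_one, X_pow_eq_monomial]
  have hv : ∀ u, (∑ t ∈ s, Finsupp.single t (d - 1)) u = if u ∈ s then d - 1 else 0 := by
    intro u
    rw [Finsupp.finsetSum_apply, ← Finset.sum_ite_eq s u fun _ => d - 1]
    exact Finset.sum_congr rfl fun t _ => by simp only [Finsupp.single_apply, eq_comm]
  have hlt : d - 1 < d := by omega
  rw [h, powerRetract_monomial, if_pos]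
  · have : (∑ t ∈ s, Finsupp.single t (d - 1)).mapRange (· / d) (Nat.zero_div d) = 0 := by
      ext u
      rw [Finsupp.mapRange_apply, hv]
      split_ifs <;> simp [hlt]
    rw [this]
    rfl
  · intro u
    rw [hv]
    split_ifs
    · exact Nat.mod_eq_of_lt hlt
    · exact Nat.zero_mod d

lemma powerFactor_mul_mem_idealPiece {n : ℕ} {d : ℕ} (hd : 0 < d)
    {I : Ideal (MvPolynomial (Fin n) K)} {k : ℤ} {f : MvPolynomial (Fin n) K}
    (hf : f ∈ idealPiece I k) (s : Finset (Fin n)) :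
    powerFactor K d s * powerMap K n d f ∈
      idealPiece (I.map (powerMap K n d)) (d * k + (d - 1 : ℤ) * s.card) := by
  by_cases hk : 0 ≤ k
  · rw [idealPiece, if_pos hk] at hf
    have hdeg : (powerFactor K d s * powerMap K n d f).IsHomogeneous
        ((∑ t ∈ s, 1 * (d - 1)) + d * k.toNat) := by
      refine IsHomogeneous.mul (IsHomogeneous.prod _ _ _ fun t _ => (isHomogeneous_X K t).pow _) ?_
      refine IsHomogeneous.aeval ((mem_homogeneousSubmodule _ _).1 hf.2) _ fun t => ?_
      simpa using (isHomogeneous_X K t).pow d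
    have hk' : (d * k + (d - 1 : ℤ) * s.card) =
        (((∑ t ∈ s, 1 * (d - 1)) + d * k.toNat : ℕ) : ℤ) := by
      rw [Finset.sum_const, smul_eq_mul]
      push_cast [Int.toNat_of_nonneg hk, Nat.cast_sub (show 1 ≤ d from hd)]
      ring
    rw [hk', idealPiece, if_pos (Int.natCast_nonneg _), Int.toNat_natCast]
    exact ⟨Ideal.mul_mem_left _ _ (Ideal.mem_map_of_mem _ hf.1),
      (mem_homogeneousSubmodule _ _).2 hdeg⟩
  · rw [idealPiece, if_neg hk, Submodule.mem_bot] at hf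
    rw [hf, map_zero, mul_zero]
    exact zero_mem _

lemma powerRetract_mem_of_mem_map {n : ℕ} {d : ℕ} (hd : 0 < d)
    {I : Ideal (MvPolynomial (Fin n) K)} {f : MvPolynomial (Fin n) K}
    (hf : f ∈ I.map (powerMap K n d)) (s : Finset (Fin n)) : powerRetract K d s f ∈ I := by
  rw [Ideal.map] at hf
  have main : ∀ c : MvPolynomial (Fin n) K, powerRetract K d s (c * f) ∈ I := by
    refine Submodule.span_induction ?_ ?_ ?_ ?_ hf
    · rintro _ ⟨g, hg, rfl⟩ c
      rw [mul_comm]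
      change powerRetract K d s (powerMap K n d g * c) ∈ I
      rw [powerRetract_powerMap_mul hd]
      exact I.mul_mem_right _ hg
    · simp
    · intro x y _ _ hx hy c
      rw [mul_add, map_add]
      exact add_mem (hx c) (hy c)
    · intro a x _ hx c
      rw [smul_eq_mul, ← mul_assoc]
      exact hx _
  simpa using main 1

lemma powerRetract_mem_idealPiece {n : ℕ} {d : ℕ} (hd : 0 < d)
    {I : Ideal (MvPolynomial (Fin n) K)} {k : ℤ} {f : MvPolynomial (Fin n) K}
    {s : Finset (Fin n)}
    (hf : f ∈ idealPiece (I.map (powerMap K n d)) (d * k + (d - 1 : ℤ) * s.card)) :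
    powerRetract K d s f ∈ idealPiece I k := by
  rw [mem_idealPiece_iff] at hf
  have hI := powerRetract_mem_of_mem_map hd hf.1 s
  have htop : powerRetract K d s f ∈ idealPiece ⊤ k := by
    rw [f.as_sum, map_sum]
    refine Submodule.sum_mem _ fun m hm => ?_
    rw [powerRetract_monomial]
    split_ifs with h
    · rw [mem_idealPiece_iff]
      refine ⟨trivial, fun m' hm' => ?_⟩
      obtain rfl := Finset.mem_singleton.1 (support_monomial_subset hm')
      have hdeg := hf.2 m hm
      have hsum : Finsupp.degree m =
          d * Finsupp.degree (m.mapRange (· / d) (Nat.zero_div d)) + (d - 1) * s.card := by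
        rw [Finsupp.degree_eq_sum, Finsupp.degree_eq_sum, Finset.mul_sum]
        have h1 : (d - 1) * s.card = ∑ u : Fin n, if u ∈ s then d - 1 else 0 := by
          simp [mul_comm]
        rw [h1, ← Finset.sum_add_distrib]
        refine Finset.sum_congr rfl fun u _ => ?_
        rw [← h u, Finsupp.mapRange_apply, Nat.div_add_mod]
      rw [hsum] at hdeg
      push_cast [Nat.cast_sub (show 1 ≤ d from hd)] at hdeg
      exact mul_left_cancel₀ (Int.natCast_ne_zero.2 hd.ne') (add_right_cancel hdeg)
    · exact zero_mem _
  rw [mem_idealPiece_iff] at htop ⊢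
  exact ⟨hI, htop.2⟩

lemma X_mul_powerFactor_insert {n : ℕ} {d : ℕ} (hd : 0 < d) {s : Finset (Fin n)} {t : Fin n}
    (ht : t ∉ s) :
    X t * powerFactor K d (insert t s) = powerFactor K d s * powerMap K n d (X t) := by
  rw [powerFactor, Finset.prod_insert ht, powerFactor, aeval_X, ← mul_assoc, ← pow_succ',
    Nat.sub_add_cancel hd, mul_comm]

lemma koszulD_powerFactor_mul {n : ℕ} {d : ℕ} (hd : 0 < d)
    (w : Finset (Fin n) → MvPolynomial (Fin n) K) :
    koszulD K n (fun s => powerFactor K d s * powerMap K n d (w s)) =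
      fun s => powerFactor K d s * powerMap K n d (koszulD K n w s) := by
  funext s
  rw [koszulD_apply, koszulD_apply, map_sum, Finset.mul_sum]
  refine Finset.sum_congr rfl fun t ht => ?_
  have h := X_mul_powerFactor_insert (K := K) hd (Finset.mem_compl.1 ht)
  have hs : powerMap K n d (koszulSign s t) = koszulSign s t := by
    rw [koszulSign, map_pow, map_neg, map_one]
  rw [map_mul, map_mul, hs]
  linear_combination (koszulSign s t * powerMap K n d (w (insert t s))) * h

lemma koszulD_powerRetract {n : ℕ} {d : ℕ} (hd : 0 < d)
    (w : Finset (Fin n) → MvPolynomial (Fin n) K) :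
    koszulD K n (fun s => powerRetract K d s (w s)) =
      fun s => powerRetract K d s (koszulD K n w s) := by
  funext s
  rw [koszulD_apply, koszulD_apply, map_sum]
  refine Finset.sum_congr rfl fun t ht => ?_
  have hs : ∀ f : MvPolynomial (Fin n) K,
      powerRetract K d s (koszulSign s t * f) = koszulSign s t * powerRetract K d s f := by
    intro f
    rcases neg_one_pow_eq_or (MvPolynomial (Fin n) K) (s.filter (fun u => u < t)).card with e | e
    · rw [koszulSign, e, one_mul, one_mul]
    · rw [koszulSign, e, neg_one_mul, neg_one_mul, map_neg]
  rw [mul_assoc, mul_assoc, hs, powerRetract_X_mul hd (Finset.mem_compl.1 ht)]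

/-- The graded Betti numbers of an ideal embed in those of its extension along `X i ↦ X i ^ d`. -/
lemma gradedBetti_map_powerMap_ne_zero {n : ℕ} {d : ℕ} (hd : 0 < d)
    {I : Ideal (MvPolynomial (Fin n) K)} {i : ℕ} {j : ℤ} (h : gradedBetti I i j ≠ 0) :
    gradedBetti (I.map (powerMap K n d)) i (d * j) ≠ 0 := by
  rw [gradedBetti_ne_zero_iff] at h ⊢
  obtain ⟨w, hw, hw0, hv⟩ := h
  refine ⟨fun s => powerFactor K d s * powerMap K n d (w s), fun s => ⟨fun hs => ?_, fun hs => ?_⟩,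
    ?_, fun v hv' hvw => ?_⟩
  · have := powerFactor_mul_mem_idealPiece hd ((hw s).1 hs) s
    rw [hs] at this
    rwa [show (d * j - i : ℤ) = d * (j - i) + (d - 1) * i by ring]
  · beta_reduce
    rw [(hw s).2 hs, map_zero, mul_zero]
  · rw [koszulD_powerFactor_mul hd, hw0]
    funext s
    rw [Pi.zero_apply, map_zero, mul_zero]
  · refine hv (fun s => powerRetract K d s (v s)) (fun s => ⟨fun hs => ?_, fun hs => ?_⟩) ?_
    · refine powerRetract_mem_idealPiece hd ?_
      have := (hv' s).1 hs
      rw [hs]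
      rwa [show (d * (j - (i + 1 : ℕ)) + (d - 1) * (i + 1 : ℕ) : ℤ) = d * j - (i + 1 : ℕ) by ring]
    · beta_reduce
      rw [(hv' s).2 hs, map_zero]
    · rw [koszulD_powerRetract hd, hvw]
      funext s
      beta_reduce
      rw [mul_comm, powerRetract_powerMap_mul hd, powerRetract_powerFactor hd, mul_one]

lemma le_reg_of_gradedBetti_ne_zero {n : ℕ} {I : Ideal (MvPolynomial (Fin n) K)} {i : ℕ} {j : ℤ}
    (h : gradedBetti I i j ≠ 0) : j - i ≤ reg I :=
  le_csSup (bddAbove_regSet I) ⟨i, j, h, rfl⟩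

lemma reg_nonneg {n : ℕ} (I : Ideal (MvPolynomial (Fin n) K)) : 0 ≤ reg I := by
  by_cases h : ∃ i j, gradedBetti I i j ≠ 0
  · obtain ⟨i, j, hij⟩ := h
    exact (nonneg_of_gradedBetti_ne_zero hij).1.trans (le_reg_of_gradedBetti_ne_zero hij)
  · push Not at h
    simp [reg, h]

/-- Let `α : R → R` be the `K`-algebra map of `R = K[x_1,…,x_n]` with `α(x_i) = x_i^d`,
`d > 0`, and let `I' = α(I)R` for a homogeneous ideal `I`.  Then `reg(I) ≤ reg(I')/d`. -/
theorem reg_le_reg_power_div {n : ℕ} (d : ℕ) (hd : 0 < d)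
    (I : Ideal (MvPolynomial (Fin n) K)) (hI : IsHomogeneousIdeal I) :
    (reg I : ℚ) ≤
      (reg (Ideal.map
        (aeval (fun i => (X i : MvPolynomial (Fin n) K) ^ d) :
          MvPolynomial (Fin n) K →ₐ[K] MvPolynomial (Fin n) K) I) : ℚ) / d := by
  rw [le_div_iff₀ (Nat.cast_pos.2 hd)]
  suffices h : reg I * d ≤ reg (I.map (powerMap K n d)) by exact_mod_cast h
  rcases Set.eq_empty_or_nonempty
    {r : ℤ | ∃ (i : ℕ) (j : ℤ), gradedBetti I i j ≠ 0 ∧ r = j - i} with he | hne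
  · rw [reg, he, Int.csSup_empty, zero_mul]
    exact reg_nonneg _
  · obtain ⟨i, j, hij, hr⟩ := Int.csSup_mem hne (bddAbove_regSet I)
    have hle := le_reg_of_gradedBetti_ne_zero (gradedBetti_map_powerMap_ne_zero hd hij)
    rw [reg, hr]
    refine le_trans ?_ hle
    have hi : (i : ℤ) ≤ i * d := le_mul_of_one_le_right (Int.natCast_nonneg i) (by exact_mod_cast hd)
    linarith
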